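/- arXiv:1510.07964 — 3 statements merged into one kernel-verified Lean document; each statement's English description precedes it below -/
import Mathlib

section
/- Let b, k ≥ 1 and let S = λ∖μ be a skew diagram which is a horizontal k-strip of b-ribbons. Then the ribbon tiling is unique: if R_1,…,R_k and R'_1,…,R'_k are two tilings of S by b-ribbons, each satisfying the condition that the northwestern-most box of every ribbon in the tiling does not lie directly below a box of another ribbon of the same tiling, then {R_1,…,R_k} = {R'_1,…,R'_k} as sets of ribbons. -/
open scoped Classical

noncomputable section

/-- The content of a box `(x, y)` is `x - y`. -/
def boxContent (c : ℕ × ℕ) : ℤ := (c.1 : ℤ) - (c.2 : ℤ)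

/-- The total content `c_λ` of a Young diagram. -/
def totalContent (μ : YoungDiagram) : ℤ := ∑ c ∈ μ.cells, boxContent c

/-- Two boxes are adjacent if they share an edge. -/
def BoxAdj (c d : ℕ × ℕ) : Prop :=
  (c.1 = d.1 ∧ (c.2 + 1 = d.2 ∨ d.2 + 1 = c.2)) ∨
  (c.2 = d.2 ∧ (c.1 + 1 = d.1 ∨ d.1 + 1 = c.1))

/-- A finite set of boxes is edge-connected. -/
def EdgeConnected (s : Finset (ℕ × ℕ)) : Prop :=
  ∀ c ∈ s, ∀ d ∈ s, Relation.ReflTransGen (fun a b => a ∈ s ∧ b ∈ s ∧ BoxAdj a b) c d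

/-- A set of boxes contains no 2 × 2 square. -/
def NoSquare (s : Finset (ℕ × ℕ)) : Prop :=
  ∀ x y : ℕ, ¬ ((x, y) ∈ s ∧ (x + 1, y) ∈ s ∧ (x, y + 1) ∈ s ∧ (x + 1, y + 1) ∈ s)

/-- The skew diagram `λ ∖ μ` is a `b`-ribbon. -/
def IsRibbon (b : ℕ) (μ lam : YoungDiagram) : Prop :=
  μ ≤ lam ∧ (lam.cells \ μ.cells).card = b ∧ EdgeConnected (lam.cells \ μ.cells) ∧
    NoSquare (lam.cells \ μ.cells)

/-- An abstract ribbon tile: a set of boxes which is a skew diagram, has `b` boxes,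
is edge-connected and contains no 2 × 2 square. -/
def IsRibbonTile (b : ℕ) (r : Finset (ℕ × ℕ)) : Prop :=
  (∃ μ lam : YoungDiagram, μ ≤ lam ∧ r = lam.cells \ μ.cells) ∧
    r.card = b ∧ EdgeConnected r ∧ NoSquare r

/-- The northwestern-most box of a ribbon: the box of minimal content
(for a ribbon, contents are consecutive and the box of minimal content is the
unique top-left end of the ribbon). -/
def IsNWBox (r : Finset (ℕ × ℕ)) (c : ℕ × ℕ) : Prop :=
  c ∈ r ∧ ∀ d ∈ r, boxContent c ≤ boxContent d

/-- `c` lies directly below `d`: same `x`-coordinate and strictly smaller `y`-coordinate. -/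
def IsBelow (c d : ℕ × ℕ) : Prop := c.1 = d.1 ∧ c.2 < d.2

/-- `R` is a tiling of `S` by `k` disjoint `b`-ribbons. -/
def IsRibbonTiling (b k : ℕ) (S : Finset (ℕ × ℕ)) (R : Fin k → Finset (ℕ × ℕ)) : Prop :=
  (∀ i, IsRibbonTile b (R i)) ∧ (∀ i j, i ≠ j → Disjoint (R i) (R j)) ∧
    S = Finset.univ.biUnion R

/-- A tiling by ribbons such that the northwestern-most box of each ribbon does not lie
directly below a box of another ribbon. -/
def IsGoodTiling (b k : ℕ) (S : Finset (ℕ × ℕ)) (R : Fin k → Finset (ℕ × ℕ)) : Prop :=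
  IsRibbonTiling b k S R ∧
    ∀ i c, IsNWBox (R i) c → ∀ j, j ≠ i → ∀ d ∈ R j, ¬ IsBelow c d

/-- `S` is a horizontal `k`-strip of `b`-ribbons. -/
def IsHorizontalStrip (b k : ℕ) (S : Finset (ℕ × ℕ)) : Prop :=
  ∃ R : Fin k → Finset (ℕ × ℕ), IsGoodTiling b k S R

/-- The height of a ribbon: the difference between the maximal and minimal `y`-coordinates
of its boxes (for a ribbon, the set of `y`-coordinates is an interval, so this is the number
of distinct `y`-coordinates minus one). -/
def ribbonHeight (r : Finset (ℕ × ℕ)) : ℕ := (r.image Prod.snd).card - 1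

/-- The height statistic of a horizontal strip of ribbons: the sum of the heights of the
ribbons in its (unique) good tiling. -/
def stripHeight (b k : ℕ) (S : Finset (ℕ × ℕ)) : ℕ :=
  sSup {h | ∃ R : Fin k → Finset (ℕ × ℕ), IsGoodTiling b k S R ∧ h = ∑ i, ribbonHeight (R i)}

/-- `μ` is obtained from `lam` by removing one `b`-ribbon. -/
def RibbonStep (b : ℕ) (lam μ : YoungDiagram) : Prop := IsRibbon b μ lam

/-- `κ` is the `b`-core of `lam`: it is obtained from `lam` by successively removing
`b`-ribbons, and admits no removable `b`-ribbon. -/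
def IsBCore (b : ℕ) (κ lam : YoungDiagram) : Prop :=
  Relation.ReflTransGen (RibbonStep b) lam κ ∧ ¬ ∃ κ', RibbonStep b κ κ'


/-- Skew diagrams are convex for the product order on boxes. -/
lemma mem_skew_of_between {μ lam : YoungDiagram} {p q c : ℕ × ℕ}
    (hp : p ∈ lam.cells \ μ.cells) (hq : q ∈ lam.cells \ μ.cells) (hpc : p ≤ c) (hcq : c ≤ q) :
    c ∈ lam.cells \ μ.cells := by
  rw [Finset.mem_sdiff] at *
  exact ⟨lam.isLowerSet hcq hq.1, fun h => hp.2 (μ.isLowerSet hpc h)⟩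

lemma IsRibbonTile.mem_of_between {b : ℕ} {r : Finset (ℕ × ℕ)} (hr : IsRibbonTile b r)
    {p q c : ℕ × ℕ} (hp : p ∈ r) (hq : q ∈ r) (hpc : p ≤ c) (hcq : c ≤ q) : c ∈ r := by
  obtain ⟨⟨μ, lam, -, rfl⟩, -⟩ := hr
  exact mem_skew_of_between hp hq hpc hcq

lemma IsRibbonTile.not_lt_of_boxContent_eq {b : ℕ} {r : Finset (ℕ × ℕ)} (hr : IsRibbonTile b r)
    {p q : ℕ × ℕ} (hp : p ∈ r) (hq : q ∈ r) (h : boxContent p = boxContent q) :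
    ¬ p.1 < q.1 := by
  intro hlt
  obtain ⟨x, y⟩ := p
  obtain ⟨x', y'⟩ := q
  simp only [boxContent] at h hlt
  have key : ∀ c : ℕ × ℕ, (x, y) ≤ c → c ≤ (x + 1, y + 1) → c ∈ r := fun c h1 h2 =>
    hr.mem_of_between hp hq h1 (h2.trans (Prod.mk_le_mk.2 ⟨by omega, by omega⟩))
  refine hr.2.2.2 x y ⟨hp, key _ ?_ ?_, key _ ?_ ?_, key _ ?_ ?_⟩ <;>
    exact Prod.mk_le_mk.2 ⟨by omega, by omega⟩

/-- A ribbon has at most one box of each content. -/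
lemma IsRibbonTile.boxContent_injOn {b : ℕ} {r : Finset (ℕ × ℕ)} (hr : IsRibbonTile b r) :
    Set.InjOn boxContent (r : Set (ℕ × ℕ)) := by
  intro p hp q hq h
  have h1 := hr.not_lt_of_boxContent_eq hp hq h
  have h2 := hr.not_lt_of_boxContent_eq hq hp h.symm
  simp only [boxContent] at h
  ext <;> omega

/-- Moving one step along a ribbon, by increasing content, keeps `x` or increases it by one. -/
lemma IsRibbonTile.fst_step {b : ℕ} {r : Finset (ℕ × ℕ)} (hr : IsRibbonTile b r)
    {p q : ℕ × ℕ} (hp : p ∈ r) (hq : q ∈ r) (h : boxContent q = boxContent p + 1) :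
    p.1 ≤ q.1 ∧ q.1 ≤ p.1 + 1 := by
  have hinj := hr.boxContent_injOn
  obtain ⟨x, y⟩ := p
  obtain ⟨x', y'⟩ := q
  simp only [boxContent] at h ⊢
  constructor
  · by_contra! hlt
    have hm : (x - 1, y - 1) ∈ r := hr.mem_of_between hq hp
      (Prod.mk_le_mk.2 ⟨by omega, by omega⟩) (Prod.mk_le_mk.2 ⟨by omega, by omega⟩)
    have := congrArg Prod.fst (hinj hm hp (by simp only [boxContent]; omega))
    simp only at this
    omega
  · by_contra! hlt
    have hm : (x + 1, y + 1) ∈ r := hr.mem_of_between hp hq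
      (Prod.mk_le_mk.2 ⟨by omega, by omega⟩) (Prod.mk_le_mk.2 ⟨by omega, by omega⟩)
    have := congrArg Prod.fst (hinj hm hp (by simp only [boxContent]; omega))
    simp only at this
    omega

lemma EdgeConnected.exists_boxContent_eq {s : Finset (ℕ × ℕ)} (hs : EdgeConnected s)
    {c d : ℕ × ℕ} (hc : c ∈ s) (hd : d ∈ s) {m : ℤ} (hcm : boxContent c ≤ m)
    (hmd : m ≤ boxContent d) : ∃ e ∈ s, boxContent e = m := by
  have h := hs c hc d hd
  clear hd
  induction h with
  | refl => exact ⟨c, hc, le_antisymm hcm hmd⟩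
  | @tail a e _ hae ih =>
    by_cases hma : m ≤ boxContent a
    · exact ih hma
    · refine ⟨e, hae.2.1, ?_⟩
      have := hae.2.2
      simp only [BoxAdj, boxContent] at *
      omega

/-- The contents of the boxes of a `b`-ribbon form an interval of length `b`. -/
lemma IsRibbonTile.exists_image_boxContent {b : ℕ} (hb : 1 ≤ b) {r : Finset (ℕ × ℕ)}
    (hr : IsRibbonTile b r) : ∃ h : ℤ, r.image boxContent = Finset.Ico h (h + b) := by
  have hcard := hr.2.1
  have hne : r.Nonempty := Finset.card_pos.1 (by omega)
  obtain ⟨p, hp, hpmin⟩ := r.exists_min_image boxContent hne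
  obtain ⟨q, hq, hqmax⟩ := r.exists_max_image boxContent hne
  have himage : r.image boxContent = Finset.Icc (boxContent p) (boxContent q) := by
    ext m
    rw [Finset.mem_image, Finset.mem_Icc]
    constructor
    · rintro ⟨c, hc, rfl⟩
      exact ⟨hpmin c hc, hqmax c hc⟩
    · rintro ⟨h1, h2⟩
      exact hr.2.2.1.exists_boxContent_eq hp hq h1 h2
  have hc := Finset.card_image_of_injOn hr.boxContent_injOn
  rw [himage, Int.card_Icc, hcard] at hc
  refine ⟨boxContent p, ?_⟩
  rw [himage]
  ext m
  rw [Finset.mem_Icc, Finset.mem_Ico]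
  omega

/-- `f` behaves like the function sending each box of `S` to the minimal content of its ribbon
in a horizontal strip of `b`-ribbons: it increases along diagonals, and each value `l` persists
on exactly the diagonals `l, …, l + b - 1`. -/
structure IsHeadLabel (b : ℕ) (S : Finset (ℕ × ℕ)) (f : ℕ × ℕ → ℤ) : Prop where
  le_boxContent : ∀ p ∈ S, f p ≤ boxContent p
  lt_of_fst_lt : ∀ p ∈ S, ∀ q ∈ S, boxContent p = boxContent q → p.1 < q.1 → f p < f q
  exists_iff : ∀ d l : ℤ, l < d → ((∃ p ∈ S, boxContent p = d ∧ f p = l) ↔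
    d < l + b ∧ ∃ p ∈ S, boxContent p = d - 1 ∧ f p = l)

/-- The boxes of `S` of content `d`. -/
def diagonal (S : Finset (ℕ × ℕ)) (d : ℤ) : Finset (ℕ × ℕ) := S.filter (boxContent · = d)

lemma mem_diagonal {S : Finset (ℕ × ℕ)} {d : ℤ} {p : ℕ × ℕ} :
    p ∈ diagonal S d ↔ p ∈ S ∧ boxContent p = d := Finset.mem_filter

lemma fst_injOn_diagonal (S : Finset (ℕ × ℕ)) (d : ℤ) :
    Set.InjOn Prod.fst (diagonal S d : Set (ℕ × ℕ)) := by
  intro p hp q hq h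
  have h1 := (mem_diagonal.1 hp).2
  have h2 := (mem_diagonal.1 hq).2
  simp only [boxContent] at h1 h2
  ext <;> omega

lemma IsHeadLabel.injOn_diagonal {b : ℕ} {S : Finset (ℕ × ℕ)} {f : ℕ × ℕ → ℤ}
    (hf : IsHeadLabel b S f) (d : ℤ) : Set.InjOn f (diagonal S d : Set (ℕ × ℕ)) := by
  intro p hp q hq h
  have hp' := mem_diagonal.1 hp
  have hq' := mem_diagonal.1 hq
  rcases lt_trichotomy p.1 q.1 with hlt | heq | hlt
  · exact absurd h (hf.lt_of_fst_lt p hp'.1 q hq'.1 (hp'.2.trans hq'.2.symm) hlt).ne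
  · exact fst_injOn_diagonal S d hp hq heq
  · exact absurd h (hf.lt_of_fst_lt q hq'.1 p hp'.1 (hq'.2.trans hp'.2.symm) hlt).ne'

lemma IsHeadLabel.image_diagonal_erase {b : ℕ} {S : Finset (ℕ × ℕ)} {f : ℕ × ℕ → ℤ}
    (hf : IsHeadLabel b S f) (d : ℤ) :
    ((diagonal S d).image f).erase d =
      ((diagonal S (d - 1)).image f).filter (fun l => d < l + b) := by
  ext l
  simp only [Finset.mem_erase, Finset.mem_image, Finset.mem_filter, mem_diagonal, and_assoc]
  constructor
  · rintro ⟨hne, p, hp, hpd, rfl⟩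
    have hlt : f p < d := lt_of_le_of_ne (hpd ▸ hf.le_boxContent p hp) hne
    obtain ⟨h1, h2⟩ := (hf.exists_iff d (f p) hlt).1 ⟨p, hp, hpd, rfl⟩
    exact ⟨h2, h1⟩
  · rintro ⟨⟨p, hp, hpd, rfl⟩, hlt⟩
    have hle := hf.le_boxContent p hp
    exact ⟨by omega, (hf.exists_iff d (f p) (by omega)).2 ⟨hlt, p, hp, hpd, rfl⟩⟩

/-- Two increasing functions on a diagonal with the same image agree. -/
lemma IsHeadLabel.eqOn_diagonal_of_image_eq {b : ℕ} {S : Finset (ℕ × ℕ)} {f g : ℕ × ℕ → ℤ}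
    (hf : IsHeadLabel b S f) (hg : IsHeadLabel b S g) {d : ℤ}
    (h : (diagonal S d).image f = (diagonal S d).image g) :
    ∀ p ∈ diagonal S d, f p = g p := by
  let X := (diagonal S d).image Prod.fst
  have hX : ∀ x : X, ∃ p ∈ diagonal S d, p.1 = x.1 := fun x => Finset.mem_image.1 x.2
  choose box hbox hbox_fst using hX
  have box_eq : ∀ p (hp : p ∈ diagonal S d), box ⟨p.1, Finset.mem_image_of_mem _ hp⟩ = p :=
    fun p hp => fst_injOn_diagonal S d (hbox _) hp (hbox_fst _)
  have mono : ∀ u : ℕ × ℕ → ℤ, IsHeadLabel b S u → StrictMono (u ∘ box) := by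
    intro u hu x y hxy
    have hx := mem_diagonal.1 (hbox x)
    have hy := mem_diagonal.1 (hbox y)
    refine hu.lt_of_fst_lt _ hx.1 _ hy.1 (hx.2.trans hy.2.symm) ?_
    rw [hbox_fst, hbox_fst]
    exact hxy
  have range_eq : ∀ u : ℕ × ℕ → ℤ, Set.range (u ∘ box) = (diagonal S d).image u := by
    intro u
    ext l
    simp only [Set.mem_range, Finset.coe_image, Set.mem_image, Finset.mem_coe, Function.comp]
    constructor
    · rintro ⟨x, rfl⟩
      exact ⟨box x, hbox x, rfl⟩
    · rintro ⟨p, hp, rfl⟩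
      exact ⟨_, congrArg u (box_eq p hp)⟩
  have hfg : f ∘ box = g ∘ box :=
    ((mono f hf).range_inj (mono g hg)).1 (by rw [range_eq, range_eq, h])
  intro p hp
  have := congrFun hfg ⟨p.1, Finset.mem_image_of_mem _ hp⟩
  simpa only [Function.comp, box_eq p hp] using this

lemma Finset.eq_of_erase_eq_of_card_eq {α : Type*} [DecidableEq α] {s t : Finset α} {a : α}
    (h : s.erase a = t.erase a) (hcard : s.card = t.card) : s = t := by
  have hmem : a ∈ s ↔ a ∈ t := by
    constructor <;> intro ha <;> by_contra hna
    · have := Finset.card_erase_lt_of_mem ha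
      rw [h, Finset.erase_eq_of_notMem hna] at this
      omega
    · have := Finset.card_erase_lt_of_mem ha
      rw [← h, Finset.erase_eq_of_notMem hna] at this
      omega
  ext c
  by_cases hca : c = a
  · rw [hca, hmem]
  · have := Finset.ext_iff.1 h c
    simpa only [Finset.mem_erase, ne_eq, hca, not_false_eq_true, true_and] using this

lemma IsHeadLabel.eqOn_diagonal_of_pred {b : ℕ} {S : Finset (ℕ × ℕ)} {f g : ℕ × ℕ → ℤ}
    (hf : IsHeadLabel b S f) (hg : IsHeadLabel b S g) {d : ℤ}
    (h : ∀ p ∈ diagonal S (d - 1), f p = g p) : ∀ p ∈ diagonal S d, f p = g p := by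
  refine hf.eqOn_diagonal_of_image_eq hg (Finset.eq_of_erase_eq_of_card_eq (a := d) ?_ ?_)
  · rw [hf.image_diagonal_erase, hg.image_diagonal_erase, Finset.image_congr h]
  · rw [Finset.card_image_of_injOn (hf.injOn_diagonal d),
      Finset.card_image_of_injOn (hg.injOn_diagonal d)]

lemma IsHeadLabel.eqOn {b : ℕ} {S : Finset (ℕ × ℕ)} {f g : ℕ × ℕ → ℤ}
    (hf : IsHeadLabel b S f) (hg : IsHeadLabel b S g) : ∀ p ∈ S, f p = g p := by
  obtain ⟨N, hN⟩ := (S.image boxContent).bddBelow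
  have hN' : ∀ p ∈ S, N ≤ boxContent p := fun p hp =>
    hN (Finset.mem_coe.2 (Finset.mem_image_of_mem _ hp))
  have key : ∀ n : ℕ, ∀ p ∈ diagonal S (N - 1 + n), f p = g p := by
    intro n
    induction n with
    | zero =>
      intro p hp
      have := hN' p (mem_diagonal.1 hp).1
      have := (mem_diagonal.1 hp).2
      push_cast at this
      omega
    | succ n ih =>
      refine hf.eqOn_diagonal_of_pred hg ?_
      rwa [show N - 1 + ((n + 1 : ℕ) : ℤ) - 1 = N - 1 + n by push_cast; ring]
  intro p hp
  have := hN' p hp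
  exact key (boxContent p - (N - 1)).toNat p (mem_diagonal.2 ⟨hp, by omega⟩)

/-- In a good tiling, ribbons are ordered along each diagonal by their minimal content. -/
lemma IsGoodTiling.head_lt_of_fst_lt {b k : ℕ} {μ lam : YoungDiagram}
    {R : Fin k → Finset (ℕ × ℕ)} (hR : IsGoodTiling b k (lam.cells \ μ.cells) R)
    {h : Fin k → ℤ} (hh : ∀ i, (R i).image boxContent = Finset.Ico (h i) (h i + b))
    (n : ℕ) : ∀ {i j : Fin k} {p q : ℕ × ℕ}, p ∈ R i → q ∈ R j → boxContent p = h i + n →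
      boxContent p = boxContent q → p.1 < q.1 → h i < h j := by
  obtain ⟨⟨htile, hdisj, hS⟩, hgood⟩ := hR
  have mem_S : ∀ {i p}, p ∈ R i → p ∈ lam.cells \ μ.cells := fun {i p} hp => by
    rw [hS]
    exact Finset.mem_biUnion.2 ⟨i, Finset.mem_univ i, hp⟩
  have content_mem : ∀ {i p}, p ∈ R i → h i ≤ boxContent p ∧ boxContent p < h i + b :=
    fun {i p} hp => Finset.mem_Ico.1 (hh i ▸ Finset.mem_image_of_mem _ hp)
  have exists_content : ∀ i m, h i ≤ m → m < h i + b → ∃ p ∈ R i, boxContent p = m :=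
    fun i m h1 h2 => Finset.mem_image.1 ((hh i).symm ▸ Finset.mem_Ico.2 ⟨h1, h2⟩)
  induction n with
  | zero =>
    intro i j p q hp hq hpn hpq hlt
    exfalso
    have hcont := hpq
    simp only [boxContent] at hcont
    have habove : (p.1, p.2 + 1) ∈ lam.cells \ μ.cells :=
      mem_skew_of_between (mem_S hp) (mem_S hq) (Prod.mk_le_mk.2 ⟨le_rfl, by omega⟩)
        (Prod.mk_le_mk.2 ⟨by omega, by omega⟩)
    rw [hS] at habove
    obtain ⟨l, -, hl⟩ := Finset.mem_biUnion.1 habove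
    refine hgood i p ⟨hp, fun d hd => ?_⟩ l ?_ _ hl ⟨rfl, Nat.lt_succ_self _⟩
    · have := (content_mem hd).1
      push_cast at hpn
      omega
    · rintro rfl
      have := (content_mem hl).1
      simp only [boxContent] at this hpn
      push_cast at this hpn
      omega
  | succ n ih =>
    intro i j p q hp hq hpn hpq hlt
    have hpi := content_mem hp
    have hqj := content_mem hq
    push_cast at hpn
    rcases hqj.1.eq_or_lt with hq0 | hq0
    · omega
    obtain ⟨p', hp', hpc⟩ := exists_content i (boxContent p - 1) (by omega) (by omega)
    obtain ⟨q', hq', hqc⟩ := exists_content j (boxContent q - 1) (by omega) (by omega)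
    have hp1 := (htile i).fst_step hp' hp (by omega)
    have hq1 := (htile j).fst_step hq' hq (by omega)
    refine ih hp' hq' (by omega) (by omega) ?_
    by_contra! hle
    have heq : p' = q' := by
      have hc : boxContent p' = boxContent q' := by omega
      simp only [boxContent] at hc
      ext <;> omega
    have hij : i = j := by
      by_contra hne
      exact Finset.disjoint_left.1 (hdisj i j hne) hp' (heq ▸ hq')
    subst hij
    exact (htile i).not_lt_of_boxContent_eq hp hq hpq hlt

/-- A good tiling is the family of level sets of a head labelling. -/
lemma IsGoodTiling.exists_isHeadLabel {b k : ℕ} (hb : 1 ≤ b) {μ lam : YoungDiagram}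
    {R : Fin k → Finset (ℕ × ℕ)} (hR : IsGoodTiling b k (lam.cells \ μ.cells) R) :
    ∃ f, IsHeadLabel b (lam.cells \ μ.cells) f ∧
      ∀ i, ∀ p ∈ R i, R i = (lam.cells \ μ.cells).filter (fun q => f q = f p) := by
  have htile := hR.1.1
  have hdisj := hR.1.2.1
  have hS := hR.1.2.2
  choose h hh using fun i => (htile i).exists_image_boxContent hb
  have mem_S : ∀ {i p}, p ∈ R i → p ∈ lam.cells \ μ.cells := fun {i p} hp => by
    rw [hS]
    exact Finset.mem_biUnion.2 ⟨i, Finset.mem_univ i, hp⟩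
  have content_mem : ∀ {i p}, p ∈ R i → h i ≤ boxContent p ∧ boxContent p < h i + b :=
    fun {i p} hp => Finset.mem_Ico.1 (hh i ▸ Finset.mem_image_of_mem _ hp)
  have exists_content : ∀ i m, h i ≤ m → m < h i + b → ∃ p ∈ R i, boxContent p = m :=
    fun i m h1 h2 => Finset.mem_image.1 ((hh i).symm ▸ Finset.mem_Ico.2 ⟨h1, h2⟩)
  have exists_mem : ∀ p ∈ lam.cells \ μ.cells, ∃ i, p ∈ R i := fun p hp => by
    rw [hS] at hp
    simpa using hp
  have index_unique : ∀ {i j p}, p ∈ R i → p ∈ R j → i = j := fun {i j p} hi hj => by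
    by_contra hne
    exact Finset.disjoint_left.1 (hdisj i j hne) hi hj
  have head_lt : ∀ {i j p q}, p ∈ R i → q ∈ R j → boxContent p = boxContent q → p.1 < q.1 →
      h i < h j := fun {i j p q} hp hq hpq hlt => by
    have := (content_mem hp).1
    exact hR.head_lt_of_fst_lt hh (boxContent p - h i).toNat hp hq (by omega) hpq hlt
  have head_inj : ∀ {i j}, h i = h j → i = j := fun {i j} hij => by
    obtain ⟨p, hp, hpc⟩ := exists_content i (h i) le_rfl (by omega)
    obtain ⟨q, hq, hqc⟩ := exists_content j (h j) le_rfl (by omega)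
    have hpq : boxContent p = boxContent q := by omega
    have h1 : ¬ p.1 < q.1 := fun hlt => (head_lt hp hq hpq hlt).ne hij
    have h2 : ¬ q.1 < p.1 := fun hlt => (head_lt hq hp hpq.symm hlt).ne' hij
    have heq : p = q := by
      simp only [boxContent] at hpq
      ext <;> omega
    exact index_unique hp (heq ▸ hq)
  let f : ℕ × ℕ → ℤ := fun p =>
    if hp : p ∈ lam.cells \ μ.cells then h (exists_mem p hp).choose else 0
  have f_eq : ∀ {i p}, p ∈ R i → f p = h i := fun {i p} hp => by
    have hpS := mem_S hp
    simp only [f, dif_pos hpS]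
    rw [index_unique (exists_mem p hpS).choose_spec hp]
  refine ⟨f, ⟨?_, ?_, ?_⟩, ?_⟩
  · intro p hp
    obtain ⟨i, hi⟩ := exists_mem p hp
    rw [f_eq hi]
    exact (content_mem hi).1
  · intro p hp q hq hpq hlt
    obtain ⟨i, hi⟩ := exists_mem p hp
    obtain ⟨j, hj⟩ := exists_mem q hq
    rw [f_eq hi, f_eq hj]
    exact head_lt hi hj hpq hlt
  · intro d l hl
    constructor
    · rintro ⟨p, hp, hpd, rfl⟩
      obtain ⟨i, hi⟩ := exists_mem p hp
      rw [f_eq hi] at hl ⊢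
      have := content_mem hi
      obtain ⟨q, hq, hqc⟩ := exists_content i (d - 1) (by omega) (by omega)
      exact ⟨by omega, q, mem_S hq, hqc, f_eq hq⟩
    · rintro ⟨hlt, p, hp, hpd, rfl⟩
      obtain ⟨i, hi⟩ := exists_mem p hp
      rw [f_eq hi] at hl hlt ⊢
      obtain ⟨q, hq, hqc⟩ := exists_content i d (by omega) (by omega)
      exact ⟨q, mem_S hq, hqc, f_eq hq⟩
  · intro i p hp
    ext q
    rw [Finset.mem_filter]
    constructor
    · intro hq
      exact ⟨mem_S hq, by rw [f_eq hq, f_eq hp]⟩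
    · rintro ⟨hq, hqp⟩
      obtain ⟨j, hj⟩ := exists_mem q hq
      rw [f_eq hj, f_eq hp] at hqp
      exact head_inj hqp ▸ hj

lemma IsGoodTiling.range_subset {b k : ℕ} (hb : 1 ≤ b) {μ lam : YoungDiagram}
    {R R' : Fin k → Finset (ℕ × ℕ)} (hR : IsGoodTiling b k (lam.cells \ μ.cells) R)
    (hR' : IsGoodTiling b k (lam.cells \ μ.cells) R') : Set.range R ⊆ Set.range R' := by
  obtain ⟨f, hf, hRf⟩ := hR.exists_isHeadLabel hb
  obtain ⟨g, hg, hRg⟩ := hR'.exists_isHeadLabel hb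
  have hfg := hf.eqOn hg
  rintro _ ⟨i, rfl⟩
  obtain ⟨p, hp⟩ : (R i).Nonempty := Finset.card_pos.1 (by rw [(hR.1.1 i).2.1]; omega)
  have hpS : p ∈ lam.cells \ μ.cells := by
    rw [hR.1.2.2]
    exact Finset.mem_biUnion.2 ⟨i, Finset.mem_univ i, hp⟩
  obtain ⟨j, hj⟩ : ∃ j, p ∈ R' j := by
    have := hpS
    rw [hR'.1.2.2] at this
    simpa using this
  refine ⟨j, ?_⟩
  rw [hRf i p hp, hRg j p hj]
  refine Finset.filter_congr fun q hq => ?_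
  rw [hfg q hq, hfg p hpS]

theorem ribbon_strip_tiling_unique (b k : ℕ) (hb : 1 ≤ b) (hk : 1 ≤ k)
    (μ lam : YoungDiagram) (hle : μ ≤ lam)
    (R R' : Fin k → Finset (ℕ × ℕ))
    (hR : IsGoodTiling b k (lam.cells \ μ.cells) R)
    (hR' : IsGoodTiling b k (lam.cells \ μ.cells) R') :
    Set.range R = Set.range R' := by
  exact (hR.range_subset hb hR').antisymm (hR'.range_subset hb hR)

end
end

section
/- Let b ≥ 1 and let λ be a partition. If μ and ν are partitions each obtained from λ by successively removing b-ribbons (i.e. there are chains λ = λ_0 ⊇ λ_1 ⊇ … ⊇ λ_r = μ and λ = ν_0 ⊇ ν_1 ⊇ … ⊇ ν_s = ν in which each consecutive skew difference is a b-ribbon), and if neither μ nor ν admits a removable b-ribbon (i.e. there is no μ' ⊆ μ with μ∖μ' a b-ribbon, and likewise for ν), then μ = ν. In other words, the b-core of λ is well defined. -/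
open scoped Classical

noncomputable section

/-- The `n`-th box on the diagonal of content `k`. -/
def diagBox (k : ℤ) (n : ℕ) : ℕ × ℕ := (n + k.toNat, n + (-k).toNat)

lemma boxContent_diagBox (k : ℤ) (n : ℕ) : boxContent (diagBox k n) = k := by
  simp only [boxContent, diagBox]; omega

lemma min_diagBox (k : ℤ) (n : ℕ) : min (diagBox k n).1 (diagBox k n).2 = n := by
  simp only [diagBox]; omega

lemma diagBox_boxContent_min (c : ℕ × ℕ) : diagBox (boxContent c) (min c.1 c.2) = c := by
  obtain ⟨x, y⟩ := c
  simp only [boxContent, diagBox, Prod.mk.injEq]; omega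

lemma diagBox_injective (k : ℤ) : Function.Injective (diagBox k) := fun m n h => by
  rw [← min_diagBox k m, h, min_diagBox]

namespace YoungDiagram

lemma mem_of_fst_le_of_snd_le {μ : YoungDiagram} {c d : ℕ × ℕ} (hd : d ∈ μ) (h₁ : c.1 ≤ d.1)
    (h₂ : c.2 ≤ d.2) : c ∈ μ :=
  μ.up_left_mem h₁ h₂ hd

lemma exists_diagBox_notMem (μ : YoungDiagram) (k : ℤ) : ∃ n, diagBox k n ∉ μ := by
  obtain ⟨n, hn⟩ := Infinite.exists_notMem_finset (μ.cells.preimage (diagBox k)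
    (diagBox_injective k).injOn)
  exact ⟨n, by simpa using hn⟩

/-- The number of boxes of `μ` of content `k`. -/
def diagLen (μ : YoungDiagram) (k : ℤ) : ℕ := Nat.find (μ.exists_diagBox_notMem k)

lemma diagBox_mem_iff {μ : YoungDiagram} {k : ℤ} {n : ℕ} :
    diagBox k n ∈ μ ↔ n < μ.diagLen k := by
  rw [diagLen, Nat.lt_find_iff]
  push Not
  refine ⟨fun h m hm => mem_of_fst_le_of_snd_le h ?_ ?_, fun h => h n le_rfl⟩ <;>
    simp only [diagBox] <;> omega

lemma mem_iff_lt_diagLen {μ : YoungDiagram} {c : ℕ × ℕ} :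
    c ∈ μ ↔ min c.1 c.2 < μ.diagLen (boxContent c) := by
  rw [← diagBox_mem_iff, diagBox_boxContent_min]

lemma diagLen_injective : Function.Injective diagLen := fun μ ν h => by
  ext c
  rw [mem_cells, mem_cells, mem_iff_lt_diagLen, mem_iff_lt_diagLen, h]

lemma card_filter_boxContent_eq (μ : YoungDiagram) (k : ℤ) :
    (μ.cells.filter (fun c => boxContent c = k)).card = μ.diagLen k := by
  rw [← Finset.card_range (μ.diagLen k), ← Finset.card_image_of_injective _ (diagBox_injective k)]
  congr 1
  ext c
  simp only [Finset.mem_filter, mem_cells, Finset.mem_image, Finset.mem_range]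
  constructor
  · rintro ⟨hc, rfl⟩
    exact ⟨_, mem_iff_lt_diagLen.1 hc, diagBox_boxContent_min c⟩
  · rintro ⟨n, hn, rfl⟩
    exact ⟨diagBox_mem_iff.2 hn, boxContent_diagBox k n⟩

lemma diagLen_le_diagLen {μ : YoungDiagram} {k l : ℤ} (i : ℕ)
    (h₁ : k.toNat ≤ i + l.toNat) (h₂ : (-k).toNat ≤ i + (-l).toNat) :
    μ.diagLen l ≤ μ.diagLen k + i := by
  by_contra! h
  have hm := diagBox_mem_iff.2 h
  refine lt_irrefl _ (diagBox_mem_iff.1 (mem_of_fst_le_of_snd_le hm ?_ ?_ :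
    diagBox k (μ.diagLen k) ∈ μ)) <;> simp only [diagBox] <;> omega

lemma diagLen_succ_of_nonneg (μ : YoungDiagram) {k : ℤ} (hk : 0 ≤ k) :
    μ.diagLen (k + 1) ≤ μ.diagLen k ∧ μ.diagLen k ≤ μ.diagLen (k + 1) + 1 :=
  ⟨diagLen_le_diagLen 0 (by omega) (by omega), diagLen_le_diagLen 1 (by omega) (by omega)⟩

lemma diagLen_succ_of_neg (μ : YoungDiagram) {k : ℤ} (hk : k < 0) :
    μ.diagLen k ≤ μ.diagLen (k + 1) ∧ μ.diagLen (k + 1) ≤ μ.diagLen k + 1 :=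
  ⟨diagLen_le_diagLen 0 (by omega) (by omega), diagLen_le_diagLen 1 (by omega) (by omega)⟩

/-- The boundary path of `μ` as a sequence of zeros and ones: the `k`-th entry records the
direction of the step separating the diagonals of contents `k` and `k + 1`. -/
def edge (μ : YoungDiagram) (k : ℤ) : ℤ :=
  μ.diagLen (k + 1) - μ.diagLen k + if 0 ≤ k then 1 else 0

lemma edge_eq_zero_or_one (μ : YoungDiagram) (k : ℤ) : μ.edge k = 0 ∨ μ.edge k = 1 := by
  unfold edge
  split_ifs with hk
  · have := μ.diagLen_succ_of_nonneg hk; omega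
  · have := μ.diagLen_succ_of_neg (not_le.1 hk); omega

lemma exists_cells_eq_of_step {s : Finset (ℕ × ℕ)} (h₁ : ∀ x y, (x + 1, y) ∈ s → (x, y) ∈ s)
    (h₂ : ∀ x y, (x, y + 1) ∈ s → (x, y) ∈ s) : ∃ μ : YoungDiagram, μ.cells = s := by
  refine ⟨⟨s, ?_⟩, rfl⟩
  have hx : ∀ n x y, (x + n, y) ∈ s → (x, y) ∈ s := fun n => by
    induction n with
    | zero => exact fun _ _ h => h
    | succ n ih => exact fun x y h => ih x y (h₁ _ _ h)
  have hy : ∀ n x y, (x, y + n) ∈ s → (x, y) ∈ s := fun n => by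
    induction n with
    | zero => exact fun _ _ h => h
    | succ n ih => exact fun x y h => ih x y (h₂ _ _ h)
  rintro ⟨x, y⟩ ⟨x', y'⟩ ⟨hxx, hyy⟩ h
  obtain ⟨m, rfl⟩ := Nat.exists_eq_add_of_le hxx
  obtain ⟨n, rfl⟩ := Nat.exists_eq_add_of_le hyy
  exact hx m _ _ (hy n _ _ h)

/-- Boxes of `μ` at the end of their diagonals, with contents in `[a, a + b)`. -/
def rim (μ : YoungDiagram) (a : ℤ) (b : ℕ) : Finset (ℕ × ℕ) :=
  μ.cells.filter fun c => (a ≤ boxContent c ∧ boxContent c < a + b) ∧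
    μ.diagLen (boxContent c) = min c.1 c.2 + 1

lemma mem_rim {μ : YoungDiagram} {a : ℤ} {b : ℕ} {c : ℕ × ℕ} :
    c ∈ μ.rim a b ↔ (a ≤ boxContent c ∧ boxContent c < a + b) ∧
      μ.diagLen (boxContent c) = min c.1 c.2 + 1 := by
  rw [rim, Finset.mem_filter, mem_cells, mem_iff_lt_diagLen]
  exact and_iff_right_of_imp fun h => by omega

lemma exists_cells_eq_sdiff_rim {μ : YoungDiagram} {a : ℤ} {b : ℕ} (h₁ : μ.edge (a - 1) = 1)
    (h₂ : μ.edge (a + b - 1) = 0) : ∃ ν : YoungDiagram, ν.cells = μ.cells \ μ.rim a b := by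
  have key : ∀ {c}, c ∈ μ.cells \ μ.rim a b ↔
      ((a ≤ boxContent c ∧ boxContent c < a + b) ∧ min c.1 c.2 + 1 < μ.diagLen (boxContent c)) ∨
      (¬ (a ≤ boxContent c ∧ boxContent c < a + b) ∧ min c.1 c.2 < μ.diagLen (boxContent c)) := by
    intro c
    rw [Finset.mem_sdiff, mem_rim, mem_cells, mem_iff_lt_diagLen]
    omega
  have H₁ : ∀ k, k = a - 1 →
      (μ.diagLen (k + 1) : ℤ) - μ.diagLen k + (if 0 ≤ k then 1 else 0) = 1 := by
    rintro k rfl; exact h₁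
  have H₂ : ∀ k, k = a + b - 1 →
      (μ.diagLen (k + 1) : ℤ) - μ.diagLen k + (if 0 ≤ k then 1 else 0) = 0 := by
    rintro k rfl; exact h₂
  apply exists_cells_eq_of_step
  · intro x y
    rw [key, key]
    obtain ⟨k, hk⟩ : ∃ k, boxContent (x, y) = k := ⟨_, rfl⟩
    have hk' : boxContent (x + 1, y) = k + 1 := by
      rw [← hk]; simp only [boxContent]; push_cast; ring
    rw [hk, hk']
    simp only [boxContent] at hk
    have H₁ := H₁ k
    have H₂ := H₂ k
    rcases le_or_gt 0 k with h0 | h0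
    · have := μ.diagLen_succ_of_nonneg h0
      simp only [h0, if_true] at H₁ H₂
      omega
    · have := μ.diagLen_succ_of_neg h0
      simp only [not_le.2 h0, if_false] at H₁ H₂
      omega
  · intro x y
    rw [key, key]
    obtain ⟨k, hk⟩ : ∃ k, boxContent (x, y + 1) = k := ⟨_, rfl⟩
    have hk' : boxContent (x, y) = k + 1 := by
      rw [← hk]; simp only [boxContent]; push_cast; ring
    rw [hk, hk']
    simp only [boxContent] at hk
    have H₁ := H₁ k
    have H₂ := H₂ k
    rcases le_or_gt 0 k with h0 | h0
    · have := μ.diagLen_succ_of_nonneg h0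
      simp only [h0, if_true] at H₁ H₂
      omega
    · have := μ.diagLen_succ_of_neg h0
      simp only [not_le.2 h0, if_false] at H₁ H₂
      omega

lemma diagLen_pos_of_edge {μ : YoungDiagram} {a : ℤ} {b : ℕ} (h₁ : μ.edge (a - 1) = 1)
    (h₂ : μ.edge (a + b - 1) = 0) {k : ℤ} (hak : a ≤ k) (hkb : k < a + b) : 0 < μ.diagLen k := by
  unfold edge at h₁ h₂
  rw [sub_add_cancel] at h₁ h₂
  rcases le_or_gt 0 k with h0 | h0
  · have := diagLen_le_diagLen (μ := μ) (k := k) (l := a + b - 1) 0 (by omega) (by omega)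
    rw [if_pos (by omega)] at h₂
    omega
  · have := diagLen_le_diagLen (μ := μ) (k := k) (l := a) 0 (by omega) (by omega)
    rw [if_neg (by omega)] at h₁
    omega

lemma eq_of_mem_rim {μ : YoungDiagram} {a : ℤ} {b : ℕ} {c d : ℕ × ℕ} (hc : c ∈ μ.rim a b)
    (hd : d ∈ μ.rim a b) (h : boxContent c = boxContent d) : c = d := by
  have hc' := (mem_rim.1 hc).2
  have hd' := (mem_rim.1 hd).2
  rw [← diagBox_boxContent_min c, ← diagBox_boxContent_min d, h]
  rw [h] at hc'
  congr 1
  omega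

lemma exists_mem_rim {μ : YoungDiagram} {a : ℤ} {b : ℕ} (h₁ : μ.edge (a - 1) = 1)
    (h₂ : μ.edge (a + b - 1) = 0) {k : ℤ} (hak : a ≤ k) (hkb : k < a + b) :
    ∃ c ∈ μ.rim a b, boxContent c = k := by
  have := diagLen_pos_of_edge h₁ h₂ hak hkb
  refine ⟨diagBox k (μ.diagLen k - 1), ?_, boxContent_diagBox _ _⟩
  rw [mem_rim, boxContent_diagBox, min_diagBox]
  omega

lemma boxAdj_of_mem_rim {μ : YoungDiagram} {a : ℤ} {b : ℕ} {c d : ℕ × ℕ} (hc : c ∈ μ.rim a b)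
    (hd : d ∈ μ.rim a b) (h : boxContent d = boxContent c + 1) : BoxAdj c d := by
  have hc' := (mem_rim.1 hc).2
  have hd' := (mem_rim.1 hd).2
  rw [h] at hd'
  have h₁ := μ.diagLen_succ_of_nonneg (k := boxContent c)
  have h₂ := μ.diagLen_succ_of_neg (k := boxContent c)
  rw [hc', hd'] at h₁ h₂
  obtain ⟨x, y⟩ := c
  obtain ⟨x', y'⟩ := d
  simp only [boxContent, BoxAdj] at *
  omega

lemma card_rim {μ : YoungDiagram} {a : ℤ} {b : ℕ} (h₁ : μ.edge (a - 1) = 1)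
    (h₂ : μ.edge (a + b - 1) = 0) : (μ.rim a b).card = b := by
  have himg : (μ.rim a b).image boxContent = Finset.Ico a (a + b) := by
    ext k
    simp only [Finset.mem_image, Finset.mem_Ico]
    constructor
    · rintro ⟨c, hc, rfl⟩; exact (mem_rim.1 hc).1
    · rintro ⟨hak, hkb⟩; exact exists_mem_rim h₁ h₂ hak hkb
  rw [← Finset.card_image_of_injOn (f := boxContent) fun c hc d hd => eq_of_mem_rim hc hd, himg]
  simp

lemma edgeConnected_rim {μ : YoungDiagram} {a : ℤ} {b : ℕ} (h₁ : μ.edge (a - 1) = 1)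
    (h₂ : μ.edge (a + b - 1) = 0) : EdgeConnected (μ.rim a b) := by
  set R := fun c d => c ∈ μ.rim a b ∧ d ∈ μ.rim a b ∧ BoxAdj c d
  have hsymm : ∀ c d, R c d → R d c := by
    rintro c d ⟨hc, hd, h⟩
    refine ⟨hd, hc, ?_⟩
    simp only [BoxAdj] at h ⊢
    omega
  have main : ∀ n : ℕ, ∀ c ∈ μ.rim a b, ∀ d ∈ μ.rim a b, boxContent d = boxContent c + n →
      Relation.ReflTransGen R c d ∧ Relation.ReflTransGen R d c := by
    intro n c hc
    induction n with
    | zero =>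
      intro d hd h
      obtain rfl := eq_of_mem_rim hc hd (by simpa using h.symm)
      exact ⟨.refl, .refl⟩
    | succ n ih =>
      intro d hd h
      push_cast at h
      have hc' := (mem_rim.1 hc).1
      have hd' := (mem_rim.1 hd).1
      obtain ⟨e, he, hek⟩ := exists_mem_rim h₁ h₂ (k := boxContent c + n) (by omega) (by omega)
      have hed : R e d := ⟨he, hd, boxAdj_of_mem_rim he hd (by omega)⟩
      exact ⟨(ih e he hek).1.tail hed, (ih e he hek).2.head (hsymm _ _ hed)⟩
  intro c hc d hd
  rcases le_total (boxContent c) (boxContent d) with h | h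
  · exact (main (boxContent d - boxContent c).toNat c hc d hd (by omega)).1
  · exact (main (boxContent c - boxContent d).toNat d hd c hc (by omega)).2

lemma exists_ribbonStep_of_edge {μ : YoungDiagram} {b : ℕ} {k : ℤ} (h₁ : μ.edge k = 1)
    (h₂ : μ.edge (k + b) = 0) : ∃ ν, RibbonStep b μ ν := by
  obtain ⟨a, rfl⟩ : ∃ a, k = a - 1 := ⟨k + 1, by ring⟩
  rw [show a - 1 + (b : ℤ) = a + b - 1 by ring] at h₂
  obtain ⟨ν, hν⟩ := exists_cells_eq_sdiff_rim h₁ h₂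
  have hdiff : μ.cells \ ν.cells = μ.rim a b := by
    rw [hν, sdiff_sdiff_right_self]
    exact inf_eq_right.2 (Finset.filter_subset _ _)
  refine ⟨ν, cells_subset_iff.1 (hν ▸ Finset.sdiff_subset), ?_, ?_, ?_⟩ <;> rw [hdiff]
  · exact card_rim h₁ h₂
  · exact edgeConnected_rim h₁ h₂
  · rintro x y ⟨h, -, -, h'⟩
    have := eq_of_mem_rim h h' (by simp [boxContent])
    simp at this

lemma edge_mono_of_no_ribbonStep {μ : YoungDiagram} {b : ℕ} (h : ¬ ∃ ν, RibbonStep b μ ν) (k : ℤ) :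
    Monotone fun j : ℤ => μ.edge (k + b * j) := by
  refine monotone_int_of_le_succ fun j => ?_
  by_contra! hlt
  have h₁ := μ.edge_eq_zero_or_one (k + b * j)
  have h₂ := μ.edge_eq_zero_or_one (k + b * (j + 1))
  refine h (exists_ribbonStep_of_edge (k := k + b * j) (by omega) ?_)
  rw [show k + b * j + (b : ℤ) = k + b * (j + 1) by ring]
  omega

/-- The number of boxes of `μ` whose content is congruent to `r` modulo `b`. -/
def residueCount (b : ℕ) (r : ℤ) (μ : YoungDiagram) : ℕ :=
  (μ.cells.filter fun c => (b : ℤ) ∣ boxContent c - r).card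

lemma residueCount_eq_sum {b : ℕ} (hb : 1 ≤ b) (r : ℤ) (μ : YoungDiagram) {T : Finset ℤ}
    (hT : μ.cells.image (fun c => (boxContent c - r) / b) ⊆ T) :
    μ.residueCount b r = ∑ j ∈ T, μ.diagLen (r + b * j) := by
  have hb' : (b : ℤ) ≠ 0 := by omega
  rw [residueCount, Finset.card_eq_sum_card_fiberwise (f := fun c => (boxContent c - r) / b)
    (t := T)]
  · refine Finset.sum_congr rfl fun j _ => ?_
    rw [← card_filter_boxContent_eq, Finset.filter_filter]
    congr 1
    refine Finset.filter_congr fun c _ => ⟨?_, fun h => ?_⟩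
    · rintro ⟨⟨m, hm⟩, rfl⟩
      rw [hm, Int.mul_ediv_cancel_left _ hb', ← hm]
      ring
    · rw [h, add_sub_cancel_left]
      exact ⟨dvd_mul_right _ _, Int.mul_ediv_cancel_left _ hb'⟩
  · intro c hc
    exact hT (Finset.mem_image_of_mem _ (Finset.mem_filter.1 hc).1)

lemma boxContent_injOn_of_isRibbon {b : ℕ} {μ lam : YoungDiagram} (h : IsRibbon b μ lam) :
    Set.InjOn boxContent (lam.cells \ μ.cells : Finset (ℕ × ℕ)) := by
  obtain ⟨-, -, -, hsq⟩ := h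
  have key : ∀ c ∈ lam.cells \ μ.cells, ∀ d ∈ lam.cells \ μ.cells, boxContent c = boxContent d →
      ¬ c.1 < d.1 := by
    rintro ⟨x, y⟩ hc ⟨x', y'⟩ hd heq hlt
    simp only [boxContent] at heq hlt
    rw [Finset.mem_sdiff, mem_cells, mem_cells] at hc hd
    have hmem : ∀ i j, x ≤ i → i ≤ x' → y ≤ j → j ≤ y' → (i, j) ∈ lam.cells \ μ.cells := by
      intro i j h₁ h₂ h₃ h₄
      rw [Finset.mem_sdiff, mem_cells, mem_cells]
      exact ⟨lam.up_left_mem h₂ h₄ hd.1, fun hm => hc.2 (μ.up_left_mem h₁ h₃ hm)⟩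
    exact hsq x y ⟨hmem _ _ (by omega) (by omega) (by omega) (by omega),
      hmem _ _ (by omega) (by omega) (by omega) (by omega),
      hmem _ _ (by omega) (by omega) (by omega) (by omega),
      hmem _ _ (by omega) (by omega) (by omega) (by omega)⟩
  intro c hc d hd heq
  have h₁ := key c hc d hd heq
  have h₂ := key d hd c hc heq.symm
  simp only [boxContent] at heq
  ext <;> omega

lemma exists_boxContent_eq_of_edgeConnected {s : Finset (ℕ × ℕ)} (hs : EdgeConnected s)
    {c d : ℕ × ℕ} (hc : c ∈ s) (hd : d ∈ s) {k : ℤ} (hck : boxContent c ≤ k)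
    (hkd : k ≤ boxContent d) : ∃ e ∈ s, boxContent e = k := by
  induction hs c hc d hd with
  | refl => exact ⟨c, hc, le_antisymm hck hkd⟩
  | @tail e f _ hef ih =>
    by_cases h : k ≤ boxContent e
    · exact ih hef.1 h
    · refine ⟨f, hd, ?_⟩
      obtain ⟨-, -, hadj⟩ := hef
      simp only [boxContent, BoxAdj] at *
      omega

lemma exists_image_boxContent_eq_Ico {b : ℕ} (hb : 1 ≤ b) {μ lam : YoungDiagram}
    (h : IsRibbon b μ lam) :
    ∃ a : ℤ, (lam.cells \ μ.cells).image boxContent = Finset.Ico a (a + b) := by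
  have hcard : ((lam.cells \ μ.cells).image boxContent).card = b := by
    rw [Finset.card_image_of_injOn (boxContent_injOn_of_isRibbon h), h.2.1]
  set I := (lam.cells \ μ.cells).image boxContent
  have hne : I.Nonempty := Finset.card_pos.1 (by omega)
  have hIcc : I = Finset.Icc (I.min' hne) (I.max' hne) := by
    ext k
    rw [Finset.mem_Icc]
    refine ⟨fun hk => ⟨I.min'_le k hk, I.le_max' k hk⟩, fun ⟨h₁, h₂⟩ => ?_⟩
    obtain ⟨c, hc, hcm⟩ := Finset.mem_image.1 (I.min'_mem hne)
    obtain ⟨d, hd, hdm⟩ := Finset.mem_image.1 (I.max'_mem hne)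
    exact Finset.mem_image.2
      (exists_boxContent_eq_of_edgeConnected h.2.2.1 hc hd (hcm ▸ h₁) (hdm ▸ h₂))
  refine ⟨I.min' hne, ?_⟩
  have hcard' := hcard
  rw [hIcc, Int.card_Icc] at hcard'
  conv_lhs => rw [hIcc]
  ext k
  rw [Finset.mem_Icc, Finset.mem_Ico]
  omega

lemma residueCount_eq_add_one {b : ℕ} (hb : 1 ≤ b) {μ lam : YoungDiagram} (h : IsRibbon b μ lam)
    (r : ℤ) : lam.residueCount b r = μ.residueCount b r + 1 := by
  obtain ⟨a, ha⟩ := exists_image_boxContent_eq_Ico hb h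
  have hone : ((lam.cells \ μ.cells).filter fun c => (b : ℤ) ∣ boxContent c - r).card = 1 := by
    rw [← Finset.card_image_of_injOn
        ((boxContent_injOn_of_isRibbon h).mono (Finset.filter_subset _ _)),
      ← Finset.filter_image (p := fun k => (b : ℤ) ∣ k - r), ha, Finset.card_eq_one]
    have hb' : (0 : ℤ) < b := by omega
    refine ⟨a + (r - a) % b, ?_⟩
    have h₀ := Int.emod_nonneg (r - a) hb'.ne'
    have h₁ := Int.emod_lt_of_pos (r - a) hb'
    ext k
    simp only [Finset.mem_filter, Finset.mem_Ico, Finset.mem_singleton]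
    constructor
    · rintro ⟨⟨hak, hkb⟩, hdvd⟩
      have hmod : (k - a) % b = (r - a) % b := by
        rw [Int.emod_eq_emod_iff_emod_sub_eq_zero, sub_sub_sub_cancel_right]
        exact Int.emod_eq_zero_of_dvd hdvd
      rw [Int.emod_eq_of_lt (by omega) (by omega)] at hmod
      omega
    · rintro rfl
      refine ⟨⟨by omega, by omega⟩, ?_⟩
      have := Int.emod_add_mul_ediv (r - a) b
      exact ⟨-((r - a) / b), by linarith⟩
  rw [residueCount, residueCount, ← hone, ← Finset.card_union_of_disjoint, ← Finset.filter_union,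
    Finset.union_sdiff_of_subset (cells_subset_iff.2 h.1)]
  exact Finset.disjoint_filter_filter Finset.disjoint_sdiff

lemma exists_residueCount_eq_add {b : ℕ} (hb : 1 ≤ b) {lam μ : YoungDiagram}
    (h : Relation.ReflTransGen (RibbonStep b) lam μ) :
    ∃ n, ∀ r, lam.residueCount b r = μ.residueCount b r + n := by
  induction h with
  | refl => exact ⟨0, fun _ => rfl⟩
  | tail _ hstep ih =>
    obtain ⟨n, hn⟩ := ih
    exact ⟨n + 1, fun r => by rw [hn, residueCount_eq_add_one hb hstep]; ring⟩

lemma eq_of_edge_eq {μ ν : YoungDiagram} (h : ∀ k, μ.edge k = ν.edge k) : μ = ν := by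
  have hstep : ∀ k : ℤ, (μ.diagLen (k + 1) : ℤ) - ν.diagLen (k + 1) =
      μ.diagLen k - ν.diagLen k := fun k => by
    have := h k
    unfold edge at this
    linarith
  have hconst : ∀ k : ℤ, (μ.diagLen k : ℤ) - ν.diagLen k = μ.diagLen 0 - ν.diagLen 0 := fun k => by
    induction k using Int.induction_on with
    | zero => rfl
    | succ n ih => rw [hstep, ih]
    | pred n ih => rw [← ih, ← hstep, sub_add_cancel]
  obtain ⟨m, hm⟩ := Infinite.exists_notMem_finset ((μ.cells ∪ ν.cells).image boxContent)
  have hzero : ∀ ρ : YoungDiagram, ρ.cells ⊆ μ.cells ∪ ν.cells → ρ.diagLen m = 0 := by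
    intro ρ hρ
    rw [← card_filter_boxContent_eq, Finset.card_eq_zero, Finset.filter_eq_empty_iff]
    exact fun c hc hcm => hm (Finset.mem_image.2 ⟨c, hρ hc, hcm⟩)
  have h0 := hconst m
  rw [hzero μ Finset.subset_union_left, hzero ν Finset.subset_union_right] at h0
  refine diagLen_injective (funext fun k => ?_)
  have := hconst k
  omega

lemma edge_eq_of_residueCount {b : ℕ} (hb : 1 ≤ b) {μ ν : YoungDiagram}
    (hμ : ¬ ∃ μ', RibbonStep b μ μ') (hν : ¬ ∃ ν', RibbonStep b ν ν') {n : ℤ}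
    (h : ∀ r, (μ.residueCount b r : ℤ) = ν.residueCount b r + n) (k : ℤ) :
    μ.edge k = ν.edge k := by
  set g : ℤ → ℤ := fun j => μ.edge (k + b * j) - ν.edge (k + b * j) with hg
  set im : YoungDiagram → ℤ → Finset ℤ :=
    fun ρ r => ρ.cells.image (fun c => (boxContent c - r) / b)
  set T : Finset ℤ := insert 0 ((im μ k ∪ im μ (k + 1)) ∪ (im ν k ∪ im ν (k + 1))) with hT
  have hsum : ∑ j ∈ T, g j = 0 := by
    have e : ∀ j, g j = ((μ.diagLen (k + 1 + b * j) : ℤ) - μ.diagLen (k + b * j)) -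
        (ν.diagLen (k + 1 + b * j) - ν.diagLen (k + b * j)) := fun j => by
      simp only [hg, edge, add_right_comm k 1]
      ring
    have hsub : im μ k ⊆ T ∧ im μ (k + 1) ⊆ T ∧ im ν k ⊆ T ∧ im ν (k + 1) ⊆ T := by
      refine ⟨?_, ?_, ?_, ?_⟩ <;> intro x hx <;>
        simp only [hT, Finset.mem_insert, Finset.mem_union, hx, true_or, or_true]
    have h₁ := residueCount_eq_sum hb k μ hsub.1
    have h₂ := residueCount_eq_sum hb (k + 1) μ hsub.2.1
    have h₃ := residueCount_eq_sum hb k ν hsub.2.2.1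
    have h₄ := residueCount_eq_sum hb (k + 1) ν hsub.2.2.2
    have h₅ := h k
    have h₆ := h (k + 1)
    rw [h₁, h₃] at h₅
    rw [h₂, h₄] at h₆
    push_cast at h₅ h₆
    simp only [e, Finset.sum_sub_distrib]
    linarith
  have hmμ := edge_mono_of_no_ribbonStep hμ k
  have hmν := edge_mono_of_no_ribbonStep hν k
  have hsign : (∀ j, 0 ≤ g j) ∨ ∀ j, g j ≤ 0 := by
    by_contra! hcon
    obtain ⟨⟨i, hi⟩, j, hj⟩ := hcon
    simp only [hg] at hi hj
    have a₁ := μ.edge_eq_zero_or_one (k + b * i)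
    have a₂ := μ.edge_eq_zero_or_one (k + b * j)
    have a₃ := ν.edge_eq_zero_or_one (k + b * i)
    have a₄ := ν.edge_eq_zero_or_one (k + b * j)
    rcases le_total i j with hij | hij
    · have := hmν hij
      dsimp only at this
      omega
    · have := hmμ hij
      dsimp only at this
      omega
  have h0 : g 0 = 0 := by
    rcases hsign with hs | hs
    · exact (Finset.sum_eq_zero_iff_of_nonneg fun j _ => hs j).1 hsum 0 (Finset.mem_insert_self _ _)
    · exact (Finset.sum_eq_zero_iff_of_nonpos fun j _ => hs j).1 hsum 0 (Finset.mem_insert_self _ _)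
  simpa [hg, sub_eq_zero] using h0

end YoungDiagram

theorem bCore_well_defined (b : ℕ) (hb : 1 ≤ b) (lam μ ν : YoungDiagram)
    (hμ : Relation.ReflTransGen (RibbonStep b) lam μ)
    (hν : Relation.ReflTransGen (RibbonStep b) lam ν)
    (hμc : ¬ ∃ μ', RibbonStep b μ μ')
    (hνc : ¬ ∃ ν', RibbonStep b ν ν') :
    μ = ν := by
  obtain ⟨m, hm⟩ := YoungDiagram.exists_residueCount_eq_add hb hμ
  obtain ⟨n, hn⟩ := YoungDiagram.exists_residueCount_eq_add hb hν
  refine YoungDiagram.eq_of_edge_eq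
    (YoungDiagram.edge_eq_of_residueCount hb hμc hνc (n := n - m) fun r => ?_)
  have h₁ := hm r
  have h₂ := hn r
  omega

end
end

section
/- Let n ≥ 1, let a ∈ ℤ and b ≥ 1 be integers with gcd(a,b) = 1, and suppose λ and μ are partitions of n such that c_λ ≠ c_μ and (a/b)·(c_λ − c_μ) ∈ ℤ. Then b ≤ n(n−1). (This is the key estimate in Proposition 4.4(a) of the paper: any wall m = a/b for the stable basis of Hilb_n has denominator b ≤ n(n−1).) -/
open scoped Classical

noncomputable section

/-- The absolute content of a box of a Young diagram is at most the number of boxes of the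
diagram strictly below it in the product order. -/
theorem abs_boxContent_le_card_lt (μ : YoungDiagram) {c : ℕ × ℕ} (hc : c ∈ μ.cells) :
    |boxContent c| ≤ ((μ.cells.filter (fun d => d < c)).card : ℤ) := by
  obtain ⟨x, y⟩ := c
  have hx : x ≤ (μ.cells.filter (fun d => d < (x, y))).card := by
    calc x = ((Finset.range x).image (fun k => (k, y))).card := by
          rw [Finset.card_image_of_injective _ (Prod.mk_left_injective y), Finset.card_range]
      _ ≤ _ := Finset.card_le_card fun d hd => by
          obtain ⟨k, hk, rfl⟩ := Finset.mem_image.1 hd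
          have hk := Finset.mem_range.1 hk
          exact Finset.mem_filter.2
            ⟨μ.up_left_mem hk.le le_rfl hc, Prod.mk_lt_mk_iff_left.2 hk⟩
  have hy : y ≤ (μ.cells.filter (fun d => d < (x, y))).card := by
    calc y = ((Finset.range y).image (fun k => (x, k))).card := by
          rw [Finset.card_image_of_injective _ (Prod.mk_right_injective x), Finset.card_range]
      _ ≤ _ := Finset.card_le_card fun d hd => by
          obtain ⟨k, hk, rfl⟩ := Finset.mem_image.1 hd
          have hk := Finset.mem_range.1 hk
          exact Finset.mem_filter.2
            ⟨μ.up_left_mem le_rfl hk.le hc, Prod.mk_lt_mk_iff_right.2 hk⟩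
  rw [boxContent, abs_le]
  constructor <;> dsimp only <;> omega

/-- A finite set of cardinality `n` in a partial order has at most `n * (n - 1) / 2` pairs of
comparable distinct elements. -/
theorem two_mul_sum_card_lt_le {α : Type*} [PartialOrder α] (s : Finset α) :
    2 * ∑ c ∈ s, (s.filter (fun d => d < c)).card ≤ s.card * (s.card - 1) := by
  have hswap : ∑ c ∈ s, (s.filter (fun d => d < c)).card =
      ∑ c ∈ s, (s.filter (fun d => c < d)).card :=
    (Finset.sum_card_bipartiteAbove_eq_sum_card_bipartiteBelow (fun c d : α => c < d)).symm
  calc 2 * ∑ c ∈ s, (s.filter (fun d => d < c)).card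
      = ∑ c ∈ s, ((s.filter (fun d => d < c)).card + (s.filter (fun d => c < d)).card) := by
        rw [Finset.sum_add_distrib, ← hswap, two_mul]
    _ ≤ ∑ _c ∈ s, (s.card - 1) := Finset.sum_le_sum fun c hc => by
        rw [← Finset.card_erase_of_mem hc, ← Finset.card_union_of_disjoint]
        · refine Finset.card_le_card fun d hd => ?_
          simp only [Finset.mem_union, Finset.mem_filter] at hd
          rcases hd with ⟨hd, h⟩ | ⟨hd, h⟩
          · exact Finset.mem_erase.2 ⟨h.ne, hd⟩
          · exact Finset.mem_erase.2 ⟨h.ne', hd⟩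
        · exact Finset.disjoint_filter.2 fun d _ h h' => lt_asymm h h'
    _ = s.card * (s.card - 1) := by rw [Finset.sum_const, smul_eq_mul]

theorem two_mul_abs_totalContent_le (μ : YoungDiagram) :
    2 * |totalContent μ| ≤ ((μ.cells.card * (μ.cells.card - 1) : ℕ) : ℤ) := by
  have h : |totalContent μ| ≤ ∑ c ∈ μ.cells, ((μ.cells.filter (fun d => d < c)).card : ℤ) :=
    (Finset.abs_sum_le_sum_abs _ _).trans
      (Finset.sum_le_sum fun _ hc => abs_boxContent_le_card_lt μ hc)
  have h' : ((2 * ∑ c ∈ μ.cells, (μ.cells.filter (fun d => d < c)).card : ℕ) : ℤ) ≤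
      ((μ.cells.card * (μ.cells.card - 1) : ℕ) : ℤ) :=
    Int.ofNat_le.2 (two_mul_sum_card_lt_le μ.cells)
  rw [Nat.cast_mul, Nat.cast_sum] at h'
  exact (mul_le_mul_of_nonneg_left h zero_le_two).trans h'

theorem wall_denominator_bound (n : ℕ) (hn : 1 ≤ n) (a : ℤ) (b : ℕ) (hb : 1 ≤ b)
    (hgcd : Int.gcd a b = 1) (lam μ : YoungDiagram)
    (hlam : lam.cells.card = n) (hμ : μ.cells.card = n)
    (hne : totalContent lam ≠ totalContent μ)
    (hint : ∃ z : ℤ, (a : ℚ) / (b : ℚ) * ((totalContent lam : ℚ) - (totalContent μ : ℚ)) = (z : ℚ)) :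
    b ≤ n * (n - 1) := by
  obtain ⟨z, hz⟩ := hint
  have hb0 : (b : ℚ) ≠ 0 := Nat.cast_ne_zero.2 (by omega)
  have hmul : a * (totalContent lam - totalContent μ) = b * z := by
    have : (a : ℚ) * ((totalContent lam : ℚ) - totalContent μ) = b * z := by
      rw [← hz]
      field_simp
    exact_mod_cast this
  have hdvd : (b : ℤ) ∣ totalContent lam - totalContent μ :=
    Int.dvd_of_dvd_mul_right_of_gcd_one ⟨z, hmul⟩ (by rw [Int.gcd_comm]; exact hgcd)
  have hle : (b : ℤ) ≤ |totalContent lam - totalContent μ| :=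
    Int.le_of_dvd (abs_pos.2 (sub_ne_zero.2 hne)) ((dvd_abs _ _).2 hdvd)
  have h₁ := two_mul_abs_totalContent_le lam
  have h₂ := two_mul_abs_totalContent_le μ
  have h₃ := abs_sub (totalContent lam) (totalContent μ)
  rw [hlam] at h₁
  rw [hμ] at h₂
  have : (b : ℤ) ≤ ((n * (n - 1) : ℕ) : ℤ) := by linarith
  exact Int.ofNat_le.1 this

end
end
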